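/- Let 𝓔 and 𝓖 be nonempty Fraïssé classes of finite structures in disjoint relational signatures, each with the disjoint amalgamation property, and let U be the Fraïssé limit of 𝓔 ⋈ 𝓖. Then the restriction maps h ↦ h↾L^U and h ↦ h↾R^U are injective group homomorphisms from Aut(U) into Aut(L^U) and Aut(R^U), respectively (where L^U carries the induced 𝓔-structure and R^U the induced 𝓖-structure). -/

import Mathlib

open FirstOrder CategoryTheory FirstOrder.Language

/-- The language of the mixed sum of two relational languages `L1`, `L2`: their (disjoint)
union together with two unary predicates `L` (coded by `true`) and `R` (coded by `false`)
and a binary relation `∼`. -/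
def mixLang (L1 L2 : FirstOrder.Language.{0, 0}) : FirstOrder.Language where
  Functions _ := Empty
  Relations n := (L1.Relations n ⊕ L2.Relations n) ⊕
    (match n with
      | 1 => Bool
      | 2 => Unit
      | _ => Empty)

instance (L1 L2 : FirstOrder.Language.{0, 0}) (n : ℕ) :
    IsEmpty ((mixLang L1 L2).Functions n) :=
  inferInstanceAs (IsEmpty Empty)

variable (L1 L2 : FirstOrder.Language.{0, 0})

/-- The left-side predicate `L`. -/
def mixL {M : Type} [(mixLang L1 L2).Structure M] (x : M) : Prop :=
  Structure.RelMap (L := mixLang L1 L2) (n := 1) (Sum.inr true) ![x]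

/-- The right-side predicate `R`. -/
def mixR {M : Type} [(mixLang L1 L2).Structure M] (x : M) : Prop :=
  Structure.RelMap (L := mixLang L1 L2) (n := 1) (Sum.inr false) ![x]

/-- The bipartite edge relation `∼`. -/
def mixAdj {M : Type} [(mixLang L1 L2).Structure M] (x y : M) : Prop :=
  Structure.RelMap (L := mixLang L1 L2) (n := 2) (Sum.inr ()) ![x, y]

/-- The `L1`-structure induced on the left side `L^M`. -/
def mixLeftStruct [L1.IsRelational] (M : Type) [(mixLang L1 L2).Structure M] :
    L1.Structure {x : M // mixL L1 L2 x} where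
  funMap f _ := isEmptyElim f
  RelMap {n} R v := Structure.RelMap (L := mixLang L1 L2) (n := n) (Sum.inl (Sum.inl R))
    (fun i => ((v i : {x : M // mixL L1 L2 x}) : M))

/-- The `L2`-structure induced on the right side `R^M`. -/
def mixRightStruct [L2.IsRelational] (M : Type) [(mixLang L1 L2).Structure M] :
    L2.Structure {x : M // mixR L1 L2 x} where
  funMap f _ := isEmptyElim f
  RelMap {n} R v := Structure.RelMap (L := mixLang L1 L2) (n := n) (Sum.inl (Sum.inr R))
    (fun i => ((v i : {x : M // mixR L1 L2 x}) : M))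

/-- `M` is a mixed sum of a member of `E1` and a member of `E2`: `{L^M, R^M}` partitions
`M`, the `L1`-relations hold only among elements of `L^M` (which forms a structure in `E1`),
the `L2`-relations hold only among elements of `R^M` (which forms a structure in `E2`), and
`∼` is a bipartite graph relation between `L^M` and `R^M`. -/
def MixMem [L1.IsRelational] [L2.IsRelational]
    (E1 : Set (Bundled.{0} L1.Structure)) (E2 : Set (Bundled.{0} L2.Structure))
    (M : Type) [(mixLang L1 L2).Structure M] : Prop :=
  (∀ x : M, (mixL L1 L2 x ∨ mixR L1 L2 x) ∧ ¬(mixL L1 L2 x ∧ mixR L1 L2 x)) ∧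
  (∀ {n : ℕ} (R : L1.Relations n) (v : Fin n → M),
    Structure.RelMap (L := mixLang L1 L2) (Sum.inl (Sum.inl R)) v → ∀ i, mixL L1 L2 (v i)) ∧
  (∀ {n : ℕ} (R : L2.Relations n) (v : Fin n → M),
    Structure.RelMap (L := mixLang L1 L2) (Sum.inl (Sum.inr R)) v → ∀ i, mixR L1 L2 (v i)) ∧
  (∀ x y : M, mixAdj L1 L2 x y → mixAdj L1 L2 y x) ∧
  (∀ x y : M, mixAdj L1 L2 x y →
    (mixL L1 L2 x ∧ mixR L1 L2 y) ∨ (mixR L1 L2 x ∧ mixL L1 L2 y)) ∧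
  (⟨{x : M // mixL L1 L2 x}, mixLeftStruct L1 L2 M⟩ : Bundled.{0} L1.Structure) ∈ E1 ∧
  (⟨{x : M // mixR L1 L2 x}, mixRightStruct L1 L2 M⟩ : Bundled.{0} L2.Structure) ∈ E2

/-- The mixed sum `E1 ⋈ E2` of two classes of finite structures. -/
def mixClass [L1.IsRelational] [L2.IsRelational]
    (E1 : Set (Bundled.{0} L1.Structure)) (E2 : Set (Bundled.{0} L2.Structure)) :
    Set (Bundled.{0} (mixLang L1 L2).Structure) :=
  {M | Finite M ∧ MixMem L1 L2 E1 E2 M}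

/-- Disjoint (strong) amalgamation for a class of structures. -/
def DisjointAmalgamation {L : FirstOrder.Language.{0, 0}} (K : Set (Bundled.{0} L.Structure)) : Prop :=
  ∀ (M N P : Bundled.{0} L.Structure) (MN : M ↪[L] N) (MP : M ↪[L] P),
    M ∈ K → N ∈ K → P ∈ K →
      ∃ (Q : Bundled.{0} L.Structure) (NQ : N ↪[L] Q) (PQ : P ↪[L] Q),
        Q ∈ K ∧ NQ.comp MN = PQ.comp MP ∧
        ∀ (n : N) (p : P), NQ n = PQ p → ∃ m : M, n = MN m ∧ p = MP m

instance mixLeftStructI {L1 L2 : FirstOrder.Language.{0, 0}} [L1.IsRelational]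
    {M : Type} [(mixLang L1 L2).Structure M] : L1.Structure {x : M // mixL L1 L2 x} :=
  mixLeftStruct L1 L2 M

instance mixRightStructI {L1 L2 : FirstOrder.Language.{0, 0}} [L2.IsRelational]
    {M : Type} [(mixLang L1 L2).Structure M] : L2.Structure {x : M // mixR L1 L2 x} :=
  mixRightStruct L1 L2 M

/-- The automorphism group of a first-order structure, with multiplication given by
composition of automorphisms. -/
instance autGroup {L : FirstOrder.Language} {M : Type*} [L.Structure M] :
    Group (M ≃[L] M) where
  mul f g := f.comp g
  one := FirstOrder.Language.Equiv.refl L M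
  inv f := f.symm
  mul_assoc _ _ _ := rfl
  one_mul := FirstOrder.Language.Equiv.refl_comp
  mul_one := FirstOrder.Language.Equiv.comp_refl
  inv_mul_cancel := FirstOrder.Language.Equiv.symm_comp_self

section Maps

variable {L1 L2 : FirstOrder.Language.{0, 0}} {M N F : Type}
  [(mixLang L1 L2).Structure M] [(mixLang L1 L2).Structure N] [FunLike F M N]
  [(mixLang L1 L2).StrongHomClass F M N]

theorem mixL_map_iff (f : F) (x : M) : mixL L1 L2 (f x) ↔ mixL L1 L2 x := by
  have := StrongHomClass.map_rel (L := mixLang L1 L2) (n := 1) f (Sum.inr true) ![x]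
  rwa [show f ∘ ![x] = ![f x] from List.ofFn_injective rfl] at this

theorem mixR_map_iff (f : F) (x : M) : mixR L1 L2 (f x) ↔ mixR L1 L2 x := by
  have := StrongHomClass.map_rel (L := mixLang L1 L2) (n := 1) f (Sum.inr false) ![x]
  rwa [show f ∘ ![x] = ![f x] from List.ofFn_injective rfl] at this

theorem mixAdj_map_iff (f : F) (x y : M) : mixAdj L1 L2 (f x) (f y) ↔ mixAdj L1 L2 x y := by
  have := StrongHomClass.map_rel (L := mixLang L1 L2) (n := 2) f (Sum.inr ()) ![x, y]
  rwa [show f ∘ ![x, y] = ![f x, f y] from List.ofFn_injective rfl] at this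

end Maps

section Restriction

variable {L1 L2 : FirstOrder.Language.{0, 0}} [L1.IsRelational] [L2.IsRelational] {U : Type}
  [(mixLang L1 L2).Structure U]

/-- Restriction of automorphisms to the left side, as a group homomorphism. -/
def restrictLeft : (U ≃[mixLang L1 L2] U) →*
    ({x : U // mixL L1 L2 x} ≃[L1] {x : U // mixL L1 L2 x}) where
  toFun h :=
    { toEquiv := h.toEquiv.subtypeEquiv fun x => (mixL_map_iff h x).symm
      map_fun' := fun f => isEmptyElim f
      map_rel' := fun r v => h.map_rel' (Sum.inl (Sum.inl r)) fun i => (v i : U) }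
  map_one' := rfl
  map_mul' _ _ := rfl

/-- Restriction of automorphisms to the right side, as a group homomorphism. -/
def restrictRight : (U ≃[mixLang L1 L2] U) →*
    ({x : U // mixR L1 L2 x} ≃[L2] {x : U // mixR L1 L2 x}) where
  toFun h :=
    { toEquiv := h.toEquiv.subtypeEquiv fun x => (mixR_map_iff h x).symm
      map_fun' := fun f => isEmptyElim f
      map_rel' := fun r v => h.map_rel' (Sum.inl (Sum.inr r)) fun i => (v i : U) }
  map_one' := rfl
  map_mul' _ _ := rfl

end Restriction

/-- The mixed sum of two structures with edges between the two sides given by `e`. -/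
def MixSum {X Y : Type} (_e : X → Y → Prop) : Type := X ⊕ Y

namespace MixSum

section

variable {L1 L2 : FirstOrder.Language.{0, 0}} {X Y : Type} [L1.Structure X] [L2.Structure Y]
  {e : X → Y → Prop}

/-- Inclusion of the left side of a mixed sum. -/
def inl (x : X) : MixSum e := Sum.inl x

/-- Inclusion of the right side of a mixed sum. -/
def inr (y : Y) : MixSum e := Sum.inr y

theorem inl_injective : Function.Injective (inl : X → MixSum e) := Sum.inl_injective

theorem inr_injective : Function.Injective (inr : Y → MixSum e) := Sum.inr_injective

theorem inl_ne_inr (x : X) (y : Y) : (inl x : MixSum e) ≠ inr y := Sum.inl_ne_inr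

/-- The bipartite edge relation of a mixed sum. -/
def Edge (e : X → Y → Prop) : MixSum e → MixSum e → Prop
  | Sum.inl x, Sum.inr y => e x y
  | Sum.inr y, Sum.inl x => e x y
  | _, _ => False

/-- The interpretation of relation symbols in a mixed sum. -/
def relMap (e : X → Y → Prop) :
    ∀ {n : ℕ}, (mixLang L1 L2).Relations n → (Fin n → MixSum e) → Prop
  | _, Sum.inl (Sum.inl r), v => ∃ w : Fin _ → X, v = inl ∘ w ∧ Structure.RelMap r w
  | _, Sum.inl (Sum.inr r), v => ∃ w : Fin _ → Y, v = inr ∘ w ∧ Structure.RelMap r w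
  | 1, Sum.inr b, v =>
    match (b : Bool) with
    | true => ∃ x, v 0 = inl x
    | false => ∃ y, v 0 = inr y
  | 2, Sum.inr _, v => Edge e (v 0) (v 1)
  | 0, Sum.inr r, _ => Empty.elim r
  | _ + 3, Sum.inr r, _ => Empty.elim r

instance : (mixLang L1 L2).Structure (MixSum e) where
  funMap f _ := Empty.elim f
  RelMap := relMap e

theorem relMap_left_iff {n : ℕ} (r : L1.Relations n) (v : Fin n → MixSum e) :
    Structure.RelMap (L := mixLang L1 L2) (Sum.inl (Sum.inl r)) v ↔
      ∃ w : Fin n → X, v = inl ∘ w ∧ Structure.RelMap r w := by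
  match n with
  | 0 | 1 | 2 | _ + 3 => exact Iff.rfl

theorem relMap_right_iff {n : ℕ} (r : L2.Relations n) (v : Fin n → MixSum e) :
    Structure.RelMap (L := mixLang L1 L2) (Sum.inl (Sum.inr r)) v ↔
      ∃ w : Fin n → Y, v = inr ∘ w ∧ Structure.RelMap r w := by
  match n with
  | 0 | 1 | 2 | _ + 3 => exact Iff.rfl

variable [L1.IsRelational] [L2.IsRelational]

variable (L1 L2 e) in
/-- The left summand is the left side of the mixed sum. -/
noncomputable def leftEquiv : X ≃[L1] {a : MixSum e // mixL L1 L2 a} where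
  toEquiv := Equiv.ofBijective (fun x => ⟨inl x, x, rfl⟩)
    ⟨fun _ _ h => inl_injective (congrArg Subtype.val h),
      fun ⟨_, x, hx⟩ => ⟨x, Subtype.ext hx.symm⟩⟩
  map_fun' f := isEmptyElim f
  map_rel' r v := by
    refine (relMap_left_iff (L2 := L2) r (fun i => (inl (v i) : MixSum e))).trans
      ⟨?_, fun h => ⟨v, rfl, h⟩⟩
    rintro ⟨w, hw, h⟩
    rwa [show v = w from funext fun i => inl_injective (congrFun hw i)]

variable (L1 L2 e) in
/-- The right summand is the right side of the mixed sum. -/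
noncomputable def rightEquiv : Y ≃[L2] {a : MixSum e // mixR L1 L2 a} where
  toEquiv := Equiv.ofBijective (fun y => ⟨inr y, y, rfl⟩)
    ⟨fun _ _ h => inr_injective (congrArg Subtype.val h),
      fun ⟨_, y, hy⟩ => ⟨y, Subtype.ext hy.symm⟩⟩
  map_fun' f := isEmptyElim f
  map_rel' r v := by
    refine (relMap_right_iff (L1 := L1) r (fun i => (inr (v i) : MixSum e))).trans
      ⟨?_, fun h => ⟨v, rfl, h⟩⟩
    rintro ⟨w, hw, h⟩
    rwa [show v = w from funext fun i => inr_injective (congrFun hw i)]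

theorem mem_mixClass {E1 : Set (Bundled.{0} L1.Structure)} {E2 : Set (Bundled.{0} L2.Structure)}
    [hE1 : IsFraisse E1] [hE2 : IsFraisse E2] [Finite X] [Finite Y]
    (hX : (⟨X, inferInstance⟩ : Bundled.{0} L1.Structure) ∈ E1)
    (hY : (⟨Y, inferInstance⟩ : Bundled.{0} L2.Structure) ∈ E2) :
    (⟨MixSum e, inferInstance⟩ : Bundled.{0} (mixLang L1 L2).Structure) ∈ mixClass L1 L2 E1 E2 := by
  refine ⟨inferInstanceAs (Finite (X ⊕ Y)), ?_, ?_, ?_, ?_, ?_, ?_, ?_⟩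
  · rintro (x | y)
    · exact ⟨Or.inl ⟨x, rfl⟩, fun ⟨_, y, hy⟩ => inl_ne_inr x y hy⟩
    · exact ⟨Or.inr ⟨y, rfl⟩, fun ⟨⟨x, hx⟩, _⟩ => inl_ne_inr x y hx.symm⟩
  · intro n r v h i
    obtain ⟨w, rfl, -⟩ := (relMap_left_iff r v).1 h
    exact ⟨w i, rfl⟩
  · intro n r v h i
    obtain ⟨w, rfl, -⟩ := (relMap_right_iff r v).1 h
    exact ⟨w i, rfl⟩
  · rintro (x | y) (x' | y') h <;> exact h
  · rintro (x | y) (x' | y') h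
    · exact h.elim
    · exact Or.inl ⟨⟨x, rfl⟩, ⟨y', rfl⟩⟩
    · exact Or.inr ⟨⟨y, rfl⟩, ⟨x', rfl⟩⟩
    · exact h.elim
  · exact (IsFraisse.is_equiv_invariant ⟨leftEquiv L1 L2 e⟩).1 hX
  · exact (IsFraisse.is_equiv_invariant ⟨rightEquiv L1 L2 e⟩).1 hY

/-- Embeddings of the two sides of a mixed structure that are compatible with the edges combine to
an embedding into a mixed sum. -/
theorem exists_embedding {E1 : Set (Bundled.{0} L1.Structure)}
    {E2 : Set (Bundled.{0} L2.Structure)} {A : Type} [(mixLang L1 L2).Structure A]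
    (hA : MixMem L1 L2 E1 E2 A) (f : {a : A // mixL L1 L2 a} ↪[L1] X)
    (g : {a : A // mixR L1 L2 a} ↪[L2] Y)
    (hfg : ∀ a b, e (f a) (g b) ↔ mixAdj L1 L2 (a : A) (b : A)) :
    ∃ F : A ↪[mixLang L1 L2] MixSum e,
      (∀ a, F a.1 = inl (f a)) ∧ ∀ a, F a.1 = inr (g a) := by
  classical
  obtain ⟨hside, hleft, hright, hsymm, hbip, -, -⟩ := hA
  have hR {a : A} (h : ¬mixL L1 L2 a) : mixR L1 L2 a := (hside a).1.resolve_left h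
  let F (a : A) : MixSum e := if h : mixL L1 L2 a then inl (f ⟨a, h⟩) else inr (g ⟨a, hR h⟩)
  have hFl (a : {a : A // mixL L1 L2 a}) : F a.1 = inl (f a) := dif_pos a.2
  have hFr (a : {a : A // mixR L1 L2 a}) : F a.1 = inr (g a) :=
    dif_neg fun h => (hside a).2 ⟨h, a.2⟩
  have hFl' {a : A} {x : X} (h : F a = inl x) : mixL L1 L2 a := by
    by_contra h'
    exact inl_ne_inr _ _ (h.symm.trans (hFr ⟨a, hR h'⟩))
  have hFr' {a : A} {y : Y} (h : F a = inr y) : mixR L1 L2 a := by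
    by_contra h'
    exact inl_ne_inr _ _ ((hFl ⟨a, (hside a).1.resolve_right h'⟩).symm.trans h)
  have hinj : Function.Injective F := by
    intro a b hab
    rcases (hside a).1 with ha | ha
    · have hb := hFl' (hab.symm.trans (hFl ⟨a, ha⟩))
      rw [hFl ⟨a, ha⟩, hFl ⟨b, hb⟩] at hab
      exact congrArg Subtype.val (f.injective (inl_injective hab))
    · have hb := hFr' (hab.symm.trans (hFr ⟨a, ha⟩))
      rw [hFr ⟨a, ha⟩, hFr ⟨b, hb⟩] at hab
      exact congrArg Subtype.val (g.injective (inr_injective hab))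
  have hedge (a b : A) : Edge e (F a) (F b) ↔ mixAdj L1 L2 a b := by
    rcases (hside a).1 with ha | ha <;> rcases (hside b).1 with hb | hb
    · rw [hFl ⟨a, ha⟩, hFl ⟨b, hb⟩]
      refine ⟨False.elim, fun h => ?_⟩
      rcases hbip a b h with h | h
      · exact (hside b).2 ⟨hb, h.2⟩
      · exact (hside a).2 ⟨ha, h.1⟩
    · rw [hFl ⟨a, ha⟩, hFr ⟨b, hb⟩]
      exact hfg _ _
    · rw [hFr ⟨a, ha⟩, hFl ⟨b, hb⟩]
      exact (hfg ⟨b, hb⟩ ⟨a, ha⟩).trans ⟨hsymm b a, hsymm a b⟩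
    · rw [hFr ⟨a, ha⟩, hFr ⟨b, hb⟩]
      refine ⟨False.elim, fun h => ?_⟩
      rcases hbip a b h with h | h
      · exact (hside a).2 ⟨h.1, ha⟩
      · exact (hside b).2 ⟨h.2, hb⟩
  have hrel {n : ℕ} (r : (mixLang L1 L2).Relations n) (v : Fin n → A) :
      Structure.RelMap r (F ∘ v) ↔ Structure.RelMap r v := by
    match n, r with
    | n, Sum.inl (Sum.inl r) =>
      refine (relMap_left_iff r _).trans ⟨?_, fun h => ?_⟩
      · rintro ⟨w, hw, h⟩
        have hv (i) : mixL L1 L2 (v i) := hFl' (congrFun hw i)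
        have : w = f ∘ fun i => ⟨v i, hv i⟩ := funext fun i =>
          inl_injective (e := e) ((congrFun hw i).symm.trans (hFl ⟨v i, hv i⟩))
        rw [this] at h
        exact (f.map_rel r _).1 h
      · have hv := hleft r v h
        exact ⟨f ∘ fun i => ⟨v i, hv i⟩, funext fun i => hFl ⟨v i, hv i⟩, (f.map_rel r _).2 h⟩
    | n, Sum.inl (Sum.inr r) =>
      refine (relMap_right_iff r _).trans ⟨?_, fun h => ?_⟩
      · rintro ⟨w, hw, h⟩
        have hv (i) : mixR L1 L2 (v i) := hFr' (congrFun hw i)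
        have : w = g ∘ fun i => ⟨v i, hv i⟩ := funext fun i =>
          inr_injective (e := e) ((congrFun hw i).symm.trans (hFr ⟨v i, hv i⟩))
        rw [this] at h
        exact (g.map_rel r _).1 h
      · have hv := hright r v h
        exact ⟨g ∘ fun i => ⟨v i, hv i⟩, funext fun i => hFr ⟨v i, hv i⟩, (g.map_rel r _).2 h⟩
    | 1, Sum.inr b =>
      have hv : v = ![v 0] := funext fun i => by rw [Subsingleton.elim i 0]; rfl
      rw [hv]
      rcases b with _ | _
      · exact ⟨fun ⟨_, hx⟩ => hFr' hx, fun h => ⟨_, hFr ⟨v 0, h⟩⟩⟩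
      · exact ⟨fun ⟨_, hx⟩ => hFl' hx, fun h => ⟨_, hFl ⟨v 0, h⟩⟩⟩
    | 2, Sum.inr _ =>
      have hv : v = ![v 0, v 1] := List.ofFn_injective (by simp)
      rw [hv]
      exact hedge (v 0) (v 1)
    | 0, Sum.inr r => exact Empty.elim r
    | _ + 3, Sum.inr r => exact Empty.elim r
  exact ⟨{ toFun := F, inj' := hinj, map_fun' := fun f => isEmptyElim f, map_rel' := hrel },
    hFl, hFr⟩

end

end MixSum

namespace FirstOrder.Language

/-- In a Fraïssé class in a relational language, an empty member embeds into every member. -/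
theorem IsFraisse.nonempty_embedding_of_isEmpty {L : Language.{0, 0}} [L.IsRelational]
    {K : Set (Bundled.{0} L.Structure)} (hK : IsFraisse K) {M N : Bundled.{0} L.Structure}
    (hM : M ∈ K) (hN : N ∈ K) [IsEmpty M] : Nonempty (M ↪[L] N) := by
  obtain ⟨P, -, ⟨f⟩, ⟨g⟩⟩ := hK.jointEmbedding M hM N hN
  refine ⟨{ toFun := isEmptyElim, inj' := fun a => isEmptyElim a,
            map_fun' := fun f => isEmptyElim f, map_rel' := fun r v => ?_ }⟩
  rw [← f.map_rel, ← g.map_rel]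
  exact iff_of_eq (congrArg _ (funext fun i => isEmptyElim (v i)))

namespace IsFraisseLimit

variable {L1 L2 : Language.{0, 0}} [L1.IsRelational] [L2.IsRelational]
  {E1 : Set (Bundled.{0} L1.Structure)} {E2 : Set (Bundled.{0} L2.Structure)}
  {U : Type} [(mixLang L1 L2).Structure U] [Countable U]

theorem mixMem_substructure (hU : IsFraisseLimit (mixClass L1 L2 E1 E2) U)
    {S : (mixLang L1 L2).Substructure U} (hS : S.FG) : MixMem L1 L2 E1 E2 S :=
  (hU.age.subset (age.fg_substructure hS)).2

theorem mixL_or_mixR (hU : IsFraisseLimit (mixClass L1 L2 E1 E2) U) (y : U) :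
    mixL L1 L2 y ∨ mixR L1 L2 y := by
  let S := Substructure.closure (mixLang L1 L2) {y}
  have := ((hU.mixMem_substructure (Substructure.fg_closure_singleton y)).1
    ⟨y, Substructure.subset_closure rfl⟩).1
  rwa [← mixL_map_iff S.subtype, ← mixR_map_iff S.subtype] at this

/-- Extension property: a mixed sum extending a finitely generated substructure embeds over it. -/
theorem exists_extension (hU : IsFraisseLimit (mixClass L1 L2 E1 E2) U) [IsFraisse E1]
    [IsFraisse E2] {S : (mixLang L1 L2).Substructure U} (hS : S.FG)
    {X Y : Type} [L1.Structure X] [L2.Structure Y] [Finite X] [Finite Y]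
    (hX : (⟨X, inferInstance⟩ : Bundled.{0} L1.Structure) ∈ E1)
    (hY : (⟨Y, inferInstance⟩ : Bundled.{0} L2.Structure) ∈ E2)
    (e : X → Y → Prop) (f : {a : S // mixL L1 L2 a} ↪[L1] X) (g : {a : S // mixR L1 L2 a} ↪[L2] Y)
    (hfg : ∀ a b, e (f a) (g b) ↔ mixAdj L1 L2 (a : S) (b : S)) :
    ∃ F : MixSum e ↪[mixLang L1 L2] U,
      (∀ a, F (MixSum.inl (f a)) = (a : S)) ∧ ∀ a, F (MixSum.inr (g a)) = (a : S) := by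
  obtain ⟨G, hGl, hGr⟩ := MixSum.exists_embedding (hU.mixMem_substructure hS) f g hfg
  have hmem := MixSum.mem_mixClass (e := e) hX hY
  rw [← hU.age] at hmem
  have := hmem.2
  obtain ⟨F, hF⟩ := hU.ultrahomogeneous.extend_embedding
    ((Substructure.fg_iff_structure_fg S).1 hS) S.subtype G
  refine ⟨F, fun a => ?_, fun a => ?_⟩
  · rw [← hGl]
    exact (DFunLike.congr_fun hF a.1).symm
  · rw [← hGr]
    exact (DFunLike.congr_fun hF a.1).symm

theorem exists_mixL_separating (hU : IsFraisseLimit (mixClass L1 L2 E1 E2) U) (hE1 : IsFraisse E1)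
    (hE2 : IsFraisse E2)
    (hE1fin : ∀ M ∈ E1, Finite M) (hE2fin : ∀ M ∈ E2, Finite M)
    (hne1 : ∃ M ∈ E1, Nonempty M) {y z : U} (hy : mixR L1 L2 y) (hz : mixR L1 L2 z)
    (hyz : y ≠ z) :
    ∃ x, mixL L1 L2 x ∧ mixAdj L1 L2 x y ∧ ¬mixAdj L1 L2 x z := by
  let S := Substructure.closure (mixLang L1 L2) {y, z}
  have hS : S.FG := Substructure.fg_closure (Set.toFinite _)
  obtain ⟨-, -, -, -, -, hA1, hA2⟩ := hU.mixMem_substructure hS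
  have hright (a : S) : mixR L1 L2 a := by
    rw [← mixR_map_iff S.subtype]
    change mixR L1 L2 (a : U)
    rcases (Substructure.mem_closure_iff_of_isRelational _ _ _).1 a.2 with h | h
    · rwa [h]
    · rwa [Set.mem_singleton_iff.1 h]
  have : IsEmpty {a : S // mixL L1 L2 a} :=
    ⟨fun a => (hU.mixMem_substructure hS).1 a.1 |>.2 ⟨a.2, hright a.1⟩⟩
  obtain ⟨X, hX, ⟨x⟩⟩ := hne1
  have := hE1fin X hX
  have : Finite {a : S // mixR L1 L2 a} := hE2fin _ hA2
  obtain ⟨f⟩ := hE1.nonempty_embedding_of_isEmpty hA1 hX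
  let y' : {a : S // mixR L1 L2 a} := ⟨⟨y, Substructure.subset_closure (by simp)⟩, hright _⟩
  let z' : {a : S // mixR L1 L2 a} := ⟨⟨z, Substructure.subset_closure (by simp)⟩, hright _⟩
  obtain ⟨F, -, hF⟩ := hU.exists_extension hS hX hA2 (fun _ b => b = y') f
    (Embedding.refl L2 _) (fun a => isEmptyElim a)
  have hFy : F (MixSum.inr y') = y := hF y'
  have hFz : F (MixSum.inr z') = z := hF z'
  refine ⟨F (MixSum.inl x), (mixL_map_iff F _).2 ⟨x, rfl⟩, ?_, ?_⟩
  · rw [← hFy, mixAdj_map_iff]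
    exact rfl
  · rw [← hFz, mixAdj_map_iff]
    intro h
    exact hyz (congrArg (fun a => (a.1 : U)) (show z' = y' from h)).symm

theorem exists_mixR_separating (hU : IsFraisseLimit (mixClass L1 L2 E1 E2) U) (hE1 : IsFraisse E1)
    (hE2 : IsFraisse E2)
    (hE1fin : ∀ M ∈ E1, Finite M) (hE2fin : ∀ M ∈ E2, Finite M)
    (hne2 : ∃ M ∈ E2, Nonempty M) {y z : U} (hy : mixL L1 L2 y) (hz : mixL L1 L2 z)
    (hyz : y ≠ z) :
    ∃ x, mixR L1 L2 x ∧ mixAdj L1 L2 y x ∧ ¬mixAdj L1 L2 z x := by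
  let S := Substructure.closure (mixLang L1 L2) {y, z}
  have hS : S.FG := Substructure.fg_closure (Set.toFinite _)
  obtain ⟨-, -, -, -, -, hA1, hA2⟩ := hU.mixMem_substructure hS
  have hleft (a : S) : mixL L1 L2 a := by
    rw [← mixL_map_iff S.subtype]
    change mixL L1 L2 (a : U)
    rcases (Substructure.mem_closure_iff_of_isRelational _ _ _).1 a.2 with h | h
    · rwa [h]
    · rwa [Set.mem_singleton_iff.1 h]
  have : IsEmpty {a : S // mixR L1 L2 a} :=
    ⟨fun a => (hU.mixMem_substructure hS).1 a.1 |>.2 ⟨hleft a.1, a.2⟩⟩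
  obtain ⟨Y, hY, ⟨x⟩⟩ := hne2
  have := hE2fin Y hY
  have : Finite {a : S // mixL L1 L2 a} := hE1fin _ hA1
  obtain ⟨g⟩ := hE2.nonempty_embedding_of_isEmpty hA2 hY
  let y' : {a : S // mixL L1 L2 a} := ⟨⟨y, Substructure.subset_closure (by simp)⟩, hleft _⟩
  let z' : {a : S // mixL L1 L2 a} := ⟨⟨z, Substructure.subset_closure (by simp)⟩, hleft _⟩
  obtain ⟨F, hF, -⟩ := hU.exists_extension hS hA1 hY (fun a _ => a = y')
    (Embedding.refl L1 _) g (fun _ b => isEmptyElim b)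
  have hFy : F (MixSum.inl y') = y := hF y'
  have hFz : F (MixSum.inl z') = z := hF z'
  refine ⟨F (MixSum.inr x), (mixR_map_iff F _).2 ⟨x, rfl⟩, ?_, ?_⟩
  · rw [← hFy, mixAdj_map_iff]
    exact rfl
  · rw [← hFz, mixAdj_map_iff]
    intro h
    exact hyz (congrArg (fun a => (a.1 : U)) (show z' = y' from h)).symm

end IsFraisseLimit

end FirstOrder.Language

/-- For nonempty Fraïssé classes `E1`, `E2` in relational signatures with disjoint
amalgamation, the restrictions of automorphisms of the Fraïssé limit `U` of `E1 ⋈ E2` to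
the left and right sides yield injective group homomorphisms from `Aut U` into the
automorphism groups of `L^U` and of `R^U`. -/
theorem statement13 (L1 L2 : FirstOrder.Language.{0, 0}) [L1.IsRelational] [L2.IsRelational]
    (E1 : Set (Bundled.{0} L1.Structure)) (E2 : Set (Bundled.{0} L2.Structure))
    (hE1 : FirstOrder.Language.IsFraisse E1) (hE2 : FirstOrder.Language.IsFraisse E2)
    (hE1fin : ∀ M ∈ E1, Finite M) (hE2fin : ∀ M ∈ E2, Finite M)
    (hdisj1 : DisjointAmalgamation E1) (hdisj2 : DisjointAmalgamation E2)
    (hne1 : ∃ M ∈ E1, Nonempty M) (hne2 : ∃ M ∈ E2, Nonempty M) :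
    ∀ (U : Type) [(mixLang L1 L2).Structure U] [Countable U],
      FirstOrder.Language.IsFraisseLimit (mixClass L1 L2 E1 E2) U →
      (∃ φ : (U ≃[mixLang L1 L2] U) →*
          ({x : U // mixL L1 L2 x} ≃[L1] {x : U // mixL L1 L2 x}),
        Function.Injective φ ∧
        ∀ (h : U ≃[mixLang L1 L2] U) (x : {x : U // mixL L1 L2 x}),
          ((φ h) x : U) = h (x : U)) ∧
      (∃ ψ : (U ≃[mixLang L1 L2] U) →*
          ({x : U // mixR L1 L2 x} ≃[L2] {x : U // mixR L1 L2 x}),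
        Function.Injective ψ ∧
        ∀ (h : U ≃[mixLang L1 L2] U) (x : {x : U // mixR L1 L2 x}),
          ((ψ h) x : U) = h (x : U)) := by
  intro U _ _ hU
  refine ⟨⟨restrictLeft, ?_, fun _ _ => rfl⟩, ⟨restrictRight, ?_, fun _ _ => rfl⟩⟩
  · refine (injective_iff_map_eq_one _).2 fun h hh => FirstOrder.Language.Equiv.ext fun y => ?_
    have hfix (x : U) (hx : mixL L1 L2 x) : h x = x :=
      congrArg Subtype.val (DFunLike.congr_fun hh (⟨x, hx⟩ : {x : U // mixL L1 L2 x}))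
    rcases hU.mixL_or_mixR y with hy | hy
    · exact hfix y hy
    · by_contra hne
      obtain ⟨x, hx, hxy, hxz⟩ := hU.exists_mixL_separating hE1 hE2 hE1fin hE2fin hne1 hy
        ((mixR_map_iff h y).2 hy) (Ne.symm hne)
      exact hxz (by simpa only [hfix x hx] using (mixAdj_map_iff h x y).2 hxy)
  · refine (injective_iff_map_eq_one _).2 fun h hh => FirstOrder.Language.Equiv.ext fun y => ?_
    have hfix (x : U) (hx : mixR L1 L2 x) : h x = x :=
      congrArg Subtype.val (DFunLike.congr_fun hh (⟨x, hx⟩ : {x : U // mixR L1 L2 x}))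
    rcases hU.mixL_or_mixR y with hy | hy
    · by_contra hne
      obtain ⟨x, hx, hyx, hzx⟩ := hU.exists_mixR_separating hE1 hE2 hE1fin hE2fin hne2 hy
        ((mixL_map_iff h y).2 hy) (Ne.symm hne)
      exact hzx (by simpa only [hfix x hx] using (mixAdj_map_iff h y x).2 hyx)
    · exact hfix y hy
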